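/- arXiv:2003.06259 — 10 statements merged into one kernel-verified Lean document; each statement's English description precedes it below -/
import Mathlib

section
/- In the finite matrix MDP setup, the Q-functions satisfy the one-step off-policy expansion Qπ = Qμ + γ•((1 - γ•Pμ)⁻¹ * (Pπ - Pμ)) *ᵥ Qπ. -/
open Matrix

/-- `1 - γ P` is invertible (strict diagonal dominance). -/
theorem isUnit_det_aux {S : Type*} [Fintype S] [DecidableEq S]
    (γ : ℝ) (hγ0 : 0 ≤ γ) (hγ1 : γ < 1) (P : Matrix S S ℝ)
    (hP0 : ∀ s t, 0 ≤ P s t) (hP1 : ∀ s, ∑ t, P s t = 1) :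
    IsUnit (1 - γ • P).det := by
  rw [isUnit_iff_ne_zero]
  apply det_ne_zero_of_sum_row_lt_diag
  intro k
  have h1 : ∑ j ∈ Finset.univ.erase k, ‖(1 - γ • P) k j‖
      = γ * ∑ j ∈ Finset.univ.erase k, P k j := by
    rw [Finset.mul_sum]
    refine Finset.sum_congr rfl fun j hj => ?_
    have hkj : k ≠ j := (Finset.ne_of_mem_erase hj).symm
    simp [hkj, abs_of_nonneg hγ0, abs_of_nonneg (hP0 k j)]
  have h2 : P k k + ∑ j ∈ Finset.univ.erase k, P k j = 1 := by
    rw [Finset.add_sum_erase _ _ (Finset.mem_univ k), hP1]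
  have h3 : (1 - γ • P) k k = 1 - γ * P k k := by simp
  rw [h1, h3, Real.norm_eq_abs]
  refine lt_of_lt_of_le ?_ (le_abs_self _)
  have h4 : γ * P k k + γ * ∑ j ∈ Finset.univ.erase k, P k j = γ := by
    rw [← mul_add, h2, mul_one]
  linarith

/-- **One-step off-policy expansion of Q-functions.**
`Qπ = Qμ + γ•((1 - γ•Pμ)⁻¹ * (Pπ - Pμ)) *ᵥ Qπ`. -/
theorem stmt_1 {S : Type*} [Fintype S] [Nonempty S] [DecidableEq S]
    (γ : ℝ) (hγ0 : 0 ≤ γ) (hγ1 : γ < 1)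
    (Pπ Pμ : Matrix S S ℝ)
    (hPπ0 : ∀ s t, 0 ≤ Pπ s t) (hPπ1 : ∀ s, ∑ t, Pπ s t = 1)
    (hPμ0 : ∀ s t, 0 ≤ Pμ s t) (hPμ1 : ∀ s, ∑ t, Pμ s t = 1)
    (R : S → ℝ) (Qπ Qμ : S → ℝ)
    (hQπ : Qπ = (1 - γ • Pπ)⁻¹ *ᵥ R) (hQμ : Qμ = (1 - γ • Pμ)⁻¹ *ᵥ R) :
    Qπ = Qμ + (γ • ((1 - γ • Pμ)⁻¹ * (Pπ - Pμ))) *ᵥ Qπ := by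
  have hμ := isUnit_det_aux γ hγ0 hγ1 Pμ hPμ0 hPμ1
  have hπ := isUnit_det_aux γ hγ0 hγ1 Pπ hPπ0 hPπ1
  have key : γ • ((1 - γ • Pμ)⁻¹ * (Pπ - Pμ))
      = 1 - (1 - γ • Pμ)⁻¹ * (1 - γ • Pπ) := by
    have h : γ • (Pπ - Pμ) = (1 - γ • Pμ) - (1 - γ • Pπ) := by
      rw [smul_sub]; abel
    rw [← Matrix.mul_smul, h, Matrix.mul_sub, Matrix.nonsing_inv_mul _ hμ]
  have hR : (1 - γ • Pπ) *ᵥ Qπ = R := by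
    rw [hQπ, Matrix.mulVec_mulVec, Matrix.mul_nonsing_inv _ hπ, Matrix.one_mulVec]
  rw [key, Matrix.sub_mulVec, Matrix.one_mulVec, ← Matrix.mulVec_mulVec, hR, hQμ]
  abel
end

section
/- (Theorem 1, finite order) In the finite matrix MDP setup, for every K ≥ 1 one has Qπ - Qμ = (∑_{k=1}^{K} M^k *ᵥ Qμ) + M^(K+1) *ᵥ Qπ, where M = γ•((1 - γ•Pμ)⁻¹ * (Pπ - Pμ)). -/
open Matrix

theorem aux_isUnit_det {S : Type*} [Fintype S] [DecidableEq S]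
    (γ : ℝ) (hγ0 : 0 ≤ γ) (hγ1 : γ < 1) (P : Matrix S S ℝ)
    (h0 : ∀ s t, 0 ≤ P s t) (h1 : ∀ s, ∑ t, P s t = 1) :
    IsUnit (1 - γ • P).det := by
  rw [isUnit_iff_ne_zero]
  apply det_ne_zero_of_sum_row_lt_diag
  intro k
  have e : ∑ j ∈ Finset.univ.erase k, ‖(1 - γ • P) k j‖
      = γ * ∑ j ∈ Finset.univ.erase k, P k j := by
    rw [Finset.mul_sum]
    refine Finset.sum_congr rfl fun j hj => ?_
    have hne : k ≠ j := (Finset.ne_of_mem_erase hj).symm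
    simp [Matrix.one_apply_ne hne, abs_of_nonneg hγ0, abs_of_nonneg (h0 k j)]
  have s := Finset.add_sum_erase Finset.univ (fun j => P k j) (Finset.mem_univ k)
  simp only [h1 k] at s
  rw [e]
  refine lt_of_lt_of_le ?_ (le_abs_self _)
  simp only [Matrix.sub_apply, Matrix.one_apply_eq, Matrix.smul_apply, smul_eq_mul]
  have : ∑ j ∈ Finset.univ.erase k, P k j = 1 - P k k := by linarith
  rw [this]
  linarith

/-- **Theorem 1 (finite order Taylor expansion of Q-functions).**
For every `K ≥ 1`,
`Qπ - Qμ = (∑_{k=1}^{K} M^k *ᵥ Qμ) + M^(K+1) *ᵥ Qπ` where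
`M = γ•((1 - γ•Pμ)⁻¹ * (Pπ - Pμ))`. -/
theorem stmt_2 {S : Type*} [Fintype S] [Nonempty S] [DecidableEq S]
    (γ : ℝ) (hγ0 : 0 ≤ γ) (hγ1 : γ < 1)
    (Pπ Pμ : Matrix S S ℝ)
    (hPπ0 : ∀ s t, 0 ≤ Pπ s t) (hPπ1 : ∀ s, ∑ t, Pπ s t = 1)
    (hPμ0 : ∀ s t, 0 ≤ Pμ s t) (hPμ1 : ∀ s, ∑ t, Pμ s t = 1)
    (R : S → ℝ) (Qπ Qμ : S → ℝ)
    (hQπ : Qπ = (1 - γ • Pπ)⁻¹ *ᵥ R) (hQμ : Qμ = (1 - γ • Pμ)⁻¹ *ᵥ R)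
    (M : Matrix S S ℝ) (hM : M = γ • ((1 - γ • Pμ)⁻¹ * (Pπ - Pμ)))
    (K : ℕ) (hK : 1 ≤ K) :
    Qπ - Qμ = (∑ k ∈ Finset.Icc 1 K, (M ^ k) *ᵥ Qμ) + (M ^ (K + 1)) *ᵥ Qπ := by
  have uπ := aux_isUnit_det γ hγ0 hγ1 Pπ hPπ0 hPπ1
  have uμ := aux_isUnit_det γ hγ0 hγ1 Pμ hPμ0 hPμ1
  have hB : (1 - γ • Pπ) *ᵥ Qπ = R := by
    rw [hQπ, mulVec_mulVec, mul_nonsing_inv _ uπ, one_mulVec]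
  have hMA : M = 1 - (1 - γ • Pμ)⁻¹ * (1 - γ • Pπ) := by
    have h1 := nonsing_inv_mul _ uμ
    have h2 : γ • (Pπ - Pμ) = (1 - γ • Pμ) - (1 - γ • Pπ) := by
      rw [smul_sub]
      abel
    rw [hM, ← Matrix.mul_smul, h2, mul_sub, h1]
  have key : Qπ = Qμ + M *ᵥ Qπ := by
    rw [hMA, sub_mulVec, one_mulVec, ← mulVec_mulVec, hB, ← hQμ]
    abel
  clear hK
  induction K with
  | zero =>
    simp only [Finset.Icc_eq_empty_of_lt zero_lt_one, Finset.sum_empty, zero_add, pow_one]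
    exact sub_eq_of_eq_add' key
  | succ n ih =>
    rw [Finset.sum_Icc_succ_top (by omega), ih, add_assoc, pow_succ M (n + 1), ← mulVec_mulVec,
      ← mulVec_add, ← key]
end

section
/- (Theorem 1, convergent series) In the finite matrix MDP setup, if γ·‖Pπ - Pμ‖_op < 1 - γ, then the series ∑_{k=1}^{∞} Uₖ converges (entrywise) and Qπ - Qμ = ∑_{k=1}^{∞} Uₖ, where Uₖ = M^k *ᵥ Qμ and M = γ•((1 - γ•Pμ)⁻¹ * (Pπ - Pμ)). -/
open Matrix

/-- Maximum row ℓ1-norm of a matrix. -/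
noncomputable def matOpNorm {S : Type*} [Fintype S] (A : Matrix S S ℝ) : ℝ :=
  ⨆ s, ∑ t, |A s t|

section aux
attribute [local instance] Matrix.linftyOpNormedRing Matrix.linftyOpNormedAlgebra

theorem aux_norm_le {S : Type*} [Fintype S] [Nonempty S] [DecidableEq S]
    (A : Matrix S S ℝ) (c : ℝ) (h : ∀ s, ∑ t, |A s t| ≤ c) : ‖A‖ ≤ c := by
  have hc : 0 ≤ c := (Finset.sum_nonneg fun t _ => abs_nonneg _).trans (h (Classical.arbitrary S))
  lift c to NNReal using hc
  rw [Matrix.linfty_opNorm_def, NNReal.coe_le_coe]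
  refine Finset.sup_le fun s _ => ?_
  rw [← NNReal.coe_le_coe]
  simpa using h s

theorem aux_isUnit {S : Type*} [Fintype S] [Nonempty S] [DecidableEq S]
    (γ : ℝ) (hγ0 : 0 ≤ γ) (hγ1 : γ < 1) (P : Matrix S S ℝ)
    (h0 : ∀ s t, 0 ≤ P s t) (h1 : ∀ s, ∑ t, P s t = 1) :
    IsUnit (1 - γ • P).det ∧ ‖(1 - γ • P)⁻¹‖ * (1 - γ) ≤ 1 := by
  have hP : ‖P‖ ≤ 1 := aux_norm_le P 1 fun s => by
    simp [abs_of_nonneg (h0 _ _), h1]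
  have hgP : ‖γ • P‖ ≤ γ := by
    rw [norm_smul, Real.norm_of_nonneg hγ0]
    nlinarith
  have : CompleteSpace (Matrix S S ℝ) := FiniteDimensional.complete ℝ _
  have hu : IsUnit (1 - γ • P).det :=
    (Matrix.isUnit_iff_isUnit_det _).1 (isUnit_one_sub_of_norm_lt_one (hgP.trans_lt hγ1))
  refine ⟨hu, ?_⟩
  have e := Matrix.mul_nonsing_inv _ hu
  set B := (1 - γ • P)⁻¹
  have e2 : B = 1 + (γ • P) * B := by
    rw [sub_mul, one_mul, sub_eq_iff_eq_add] at e
    exact e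
  have h3 : ‖B‖ ≤ 1 + γ * ‖B‖ := by
    calc ‖B‖ = ‖1 + (γ • P) * B‖ := by rw [← e2]
      _ ≤ ‖(1 : Matrix S S ℝ)‖ + ‖(γ • P) * B‖ := norm_add_le _ _
      _ ≤ 1 + ‖γ • P‖ * ‖B‖ := by
        gcongr
        · exact norm_one.le
        · exact norm_mul_le _ _
      _ ≤ 1 + γ * ‖B‖ := by gcongr
  linarith

theorem aux_pow {S : Type*} [Fintype S] [Nonempty S] [DecidableEq S]
    (γ : ℝ) (hγ0 : 0 ≤ γ) (hγ1 : γ < 1) (P D : Matrix S S ℝ)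
    (h0 : ∀ s t, 0 ≤ P s t) (h1 : ∀ s, ∑ t, P s t = 1)
    (hsmall : γ * matOpNorm D < 1 - γ) :
    ∃ r : ℝ, 0 ≤ r ∧ r < 1 ∧ ∀ (v : S → ℝ) (k : ℕ) (s : S),
      ‖((γ • ((1 - γ • P)⁻¹ * D)) ^ k *ᵥ v) s‖ ≤ r ^ k * ‖v‖ := by
  refine ⟨‖γ • ((1 - γ • P)⁻¹ * D)‖, norm_nonneg _, ?_, fun v k s => ?_⟩
  · have hD : ‖D‖ ≤ matOpNorm D := aux_norm_le D _ fun s =>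
      le_ciSup (f := fun s => ∑ t, |D s t|) (Set.finite_range _).bddAbove s
    have hB := (aux_isUnit γ hγ0 hγ1 P h0 h1).2
    have hm := norm_mul_le (1 - γ • P)⁻¹ D
    rw [norm_smul, Real.norm_of_nonneg hγ0]
    have hs : γ * ‖D‖ < 1 - γ := (mul_le_mul_of_nonneg_left hD hγ0).trans_lt hsmall
    have hBn := norm_nonneg (1 - γ • P)⁻¹
    have hm2 := mul_le_mul_of_nonneg_left hm hγ0
    rcases hBn.eq_or_lt with h | h
    · rw [← h] at hm2
      linarith
    · nlinarith [mul_lt_mul_of_pos_left hs h]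
  · refine (norm_le_pi_norm _ s).trans ((Matrix.linfty_opNorm_mulVec _ _).trans ?_)
    gcongr
    exact norm_pow_le _ _

end aux

/-- **Theorem 1 (convergent Taylor series of Q-functions).**
If `γ·‖Pπ - Pμ‖_op < 1 - γ` then the series `∑_{k=1}^∞ Uₖ` converges entrywise and
`Qπ - Qμ = ∑_{k=1}^∞ Uₖ`, where `Uₖ = M^k *ᵥ Qμ`. -/
theorem stmt_4 {S : Type*} [Fintype S] [Nonempty S] [DecidableEq S]
    (γ : ℝ) (hγ0 : 0 ≤ γ) (hγ1 : γ < 1)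
    (Pπ Pμ : Matrix S S ℝ)
    (hPπ0 : ∀ s t, 0 ≤ Pπ s t) (hPπ1 : ∀ s, ∑ t, Pπ s t = 1)
    (hPμ0 : ∀ s t, 0 ≤ Pμ s t) (hPμ1 : ∀ s, ∑ t, Pμ s t = 1)
    (R : S → ℝ) (Qπ Qμ : S → ℝ)
    (hQπ : Qπ = (1 - γ • Pπ)⁻¹ *ᵥ R) (hQμ : Qμ = (1 - γ • Pμ)⁻¹ *ᵥ R)
    (M : Matrix S S ℝ) (hM : M = γ • ((1 - γ • Pμ)⁻¹ * (Pπ - Pμ)))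
    (hsmall : γ * matOpNorm (Pπ - Pμ) < 1 - γ) :
    ∀ s : S, HasSum (fun k : ℕ => ((M ^ (k + 1)) *ᵥ Qμ) s) ((Qπ - Qμ) s) := by
  obtain ⟨hu, -⟩ := aux_isUnit γ hγ0 hγ1 Pμ hPμ0 hPμ1
  obtain ⟨hv, -⟩ := aux_isUnit γ hγ0 hγ1 Pπ hPπ0 hPπ1
  obtain ⟨r, hr0, hr1, hr⟩ := aux_pow γ hγ0 hγ1 Pμ (Pπ - Pμ) hPμ0 hPμ1 hsmall
  rw [← hM] at hr
  have key : Qπ = Qμ + M *ᵥ Qπ := by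
    have hR : R = (1 - γ • Pπ) *ᵥ Qπ := by
      rw [hQπ, Matrix.mulVec_mulVec, Matrix.mul_nonsing_inv _ hv, Matrix.one_mulVec]
    have hE : (1 - γ • Pμ)⁻¹ * (1 - γ • Pπ) + M = 1 := by
      rw [hM, ← Matrix.mul_smul, ← mul_add]
      have h5 : (1 - γ • Pπ) + γ • (Pπ - Pμ) = 1 - γ • Pμ := by
        rw [smul_sub]
        abel
      rw [h5, Matrix.nonsing_inv_mul _ hu]
    rw [hQμ]
    conv_rhs => rw [hR]
    rw [Matrix.mulVec_mulVec, ← Matrix.add_mulVec, hE, Matrix.one_mulVec]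
  have part : ∀ n : ℕ, ∑ k ∈ Finset.range n, (M ^ (k + 1)) *ᵥ Qμ
      = (Qπ - Qμ) - M ^ n *ᵥ (Qπ - Qμ) := by
    intro n
    induction n with
    | zero => simp
    | succ n ih =>
      have h2 : Qπ - Qμ = M *ᵥ Qμ + M *ᵥ (Qπ - Qμ) := by
        rw [← Matrix.mulVec_add, add_sub_cancel]
        exact sub_eq_iff_eq_add'.2 key
      have h3 : M ^ n *ᵥ (Qπ - Qμ) = M ^ (n + 1) *ᵥ Qμ + M ^ (n + 1) *ᵥ (Qπ - Qμ) := by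
        conv_lhs => rw [h2]
        rw [Matrix.mulVec_add, Matrix.mulVec_mulVec, Matrix.mulVec_mulVec, ← pow_succ]
      rw [Finset.sum_range_succ, ih, h3]
      abel
  intro s
  have hsum : Summable (fun k : ℕ => ((M ^ (k + 1)) *ᵥ Qμ) s) := by
    refine Summable.of_norm_bounded (g := fun k : ℕ => r ^ (k + 1) * ‖Qμ‖) ?_
      (fun k => hr Qμ (k + 1) s)
    exact ((summable_nat_add_iff 1).2 (summable_geometric_of_lt_one hr0 hr1)).mul_right _
  rw [hsum.hasSum_iff_tendsto_nat]
  have hz : Filter.Tendsto (fun n : ℕ => (M ^ n *ᵥ (Qπ - Qμ)) s) Filter.atTop (nhds 0) := by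
    refine squeeze_zero_norm (hr (Qπ - Qμ) · s) ?_
    simpa using (tendsto_pow_atTop_nhds_zero_of_lt_one hr0 hr1).mul_const ‖Qπ - Qμ‖
  have h4 := hz.const_sub ((Qπ - Qμ) s)
  rw [sub_zero] at h4
  refine h4.congr fun n => ?_
  have := congrFun (part n) s
  rw [Finset.sum_apply] at this
  rw [this, Pi.sub_apply (Qπ - Qμ)]
end

section
/- In the finite matrix MDP setup, if ‖R‖_∞ ≤ Rmax and ‖Pπ - Pμ‖_op ≤ ε, then ‖Qμ‖_∞ ≤ Rmax/(1-γ), and for every k ≥ 1 the Taylor expansion terms satisfy ‖Uₖ‖_∞ ≤ (γ·ε/(1-γ))^k · Rmax/(1-γ). -/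
open Matrix

/-- Sup norm of a vector. -/
noncomputable def vecSupNorm {S : Type*} [Fintype S] (v : S → ℝ) : ℝ := ⨆ s, |v s|

theorem aux_le_sup {S : Type*} [Fintype S] (v : S → ℝ) {c : ℝ} (h : (⨆ s, v s) ≤ c) (s : S) :
    v s ≤ c :=
  (le_ciSup (Set.finite_range v).bddAbove s).trans h

theorem aux_mulVec {S : Type*} [Fintype S] (A : Matrix S S ℝ) (x : S → ℝ) (a c : ℝ)
    (hc : 0 ≤ c) (hA : ∀ s, ∑ t, |A s t| ≤ a) (hx : ∀ s, |x s| ≤ c) (s : S) :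
    |(A *ᵥ x) s| ≤ a * c := by
  calc |(A *ᵥ x) s| = |∑ t, A s t * x t| := rfl
    _ ≤ ∑ t, |A s t * x t| := Finset.abs_sum_le_sum_abs _ _
    _ ≤ ∑ t, |A s t| * c := by
        refine Finset.sum_le_sum fun t _ => ?_
        rw [abs_mul]
        exact mul_le_mul_of_nonneg_left (hx t) (abs_nonneg _)
    _ = (∑ t, |A s t|) * c := by rw [Finset.sum_mul]
    _ ≤ a * c := mul_le_mul_of_nonneg_right (hA s) hc

theorem aux_res {S : Type*} [Fintype S] [Nonempty S] [DecidableEq S]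
    (γ : ℝ) (hγ0 : 0 ≤ γ) (hγ1 : γ < 1) (P : Matrix S S ℝ)
    (hP0 : ∀ s t, 0 ≤ P s t) (hP1 : ∀ s, ∑ t, P s t = 1)
    (x v : S → ℝ) (c : ℝ) (hxv : (1 - γ • P) *ᵥ x = v) (hv : ∀ s, |v s| ≤ c) (s : S) :
    |x s| ≤ c / (1 - γ) := by
  obtain ⟨m, hm⟩ := Finite.exists_max (fun s => |x s|)
  refine (hm s).trans ?_
  rw [le_div_iff₀ (by linarith)]
  have h1 : x m = v m + γ * (P *ᵥ x) m := by
    rw [← hxv, Matrix.sub_mulVec, Matrix.one_mulVec, Matrix.smul_mulVec]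
    simp
  have h2 : |(P *ᵥ x) m| ≤ 1 * |x m| :=
    aux_mulVec P x 1 |x m| (abs_nonneg _)
      (fun s => by simp only [abs_of_nonneg (hP0 _ _), hP1, le_refl]) hm m
  have h3 : |x m| ≤ |v m| + γ * |(P *ᵥ x) m| := by
    have := abs_add_le (v m) (γ * (P *ᵥ x) m)
    rwa [← h1, abs_mul, abs_of_nonneg hγ0] at this
  have h4 := mul_le_mul_of_nonneg_left h2 hγ0
  have h5 := hv m
  nlinarith

theorem aux_inv {S : Type*} [Fintype S] [Nonempty S] [DecidableEq S]
    (γ : ℝ) (hγ0 : 0 ≤ γ) (hγ1 : γ < 1) (P : Matrix S S ℝ)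
    (hP0 : ∀ s t, 0 ≤ P s t) (hP1 : ∀ s, ∑ t, P s t = 1)
    (v : S → ℝ) (c : ℝ) (hv : ∀ s, |v s| ≤ c) (s : S) :
    |((1 - γ • P)⁻¹ *ᵥ v) s| ≤ c / (1 - γ) := by
  have hu : IsUnit (1 - γ • P) := by
    rw [← Matrix.mulVec_injective_iff_isUnit]
    intro x y hxy
    have h0 : (1 - γ • P) *ᵥ (x - y) = 0 := by
      rw [Matrix.mulVec_sub]
      exact sub_eq_zero.2 hxy
    funext t
    have := aux_res γ hγ0 hγ1 P hP0 hP1 (x - y) 0 0 h0 (by simp) t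
    rw [zero_div] at this
    exact sub_eq_zero.1 (abs_nonpos_iff.1 this)
  refine aux_res γ hγ0 hγ1 P hP0 hP1 _ v c ?_ hv s
  rw [Matrix.mulVec_mulVec, Matrix.mul_nonsing_inv _ ((Matrix.isUnit_iff_isUnit_det _).1 hu),
    Matrix.one_mulVec]

/-- **Bounds on the Taylor expansion terms.**
If `‖R‖_∞ ≤ Rmax` and `‖Pπ - Pμ‖_op ≤ ε` then `‖Qμ‖_∞ ≤ Rmax/(1-γ)` and
`‖Uₖ‖_∞ ≤ (γε/(1-γ))^k · Rmax/(1-γ)` for all `k ≥ 1`. -/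
theorem stmt_7 {S : Type*} [Fintype S] [Nonempty S] [DecidableEq S]
    (γ : ℝ) (hγ0 : 0 ≤ γ) (hγ1 : γ < 1)
    (Pπ Pμ : Matrix S S ℝ)
    (hPπ0 : ∀ s t, 0 ≤ Pπ s t) (hPπ1 : ∀ s, ∑ t, Pπ s t = 1)
    (hPμ0 : ∀ s t, 0 ≤ Pμ s t) (hPμ1 : ∀ s, ∑ t, Pμ s t = 1)
    (R : S → ℝ) (Qμ : S → ℝ) (hQμ : Qμ = (1 - γ • Pμ)⁻¹ *ᵥ R)
    (M : Matrix S S ℝ) (hM : M = γ • ((1 - γ • Pμ)⁻¹ * (Pπ - Pμ)))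
    (Rmax ε : ℝ) (hR : vecSupNorm R ≤ Rmax) (hε : matOpNorm (Pπ - Pμ) ≤ ε) :
    vecSupNorm Qμ ≤ Rmax / (1 - γ) ∧
      ∀ k : ℕ, 1 ≤ k →
        vecSupNorm ((M ^ k) *ᵥ Qμ) ≤ (γ * ε / (1 - γ)) ^ k * (Rmax / (1 - γ)) := by
  have hR' := aux_le_sup _ hR
  have hε' := aux_le_sup _ hε
  have hg : 0 < 1 - γ := by linarith
  obtain ⟨s0⟩ := ‹Nonempty S›
  haveI : Nonempty S := ⟨s0⟩
  have hR0 : 0 ≤ Rmax := (abs_nonneg _).trans (hR' s0)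
  have hε0 : 0 ≤ ε := (Finset.sum_nonneg fun t _ => abs_nonneg _).trans (hε' s0)
  have hQ : ∀ s, |Qμ s| ≤ Rmax / (1 - γ) := by
    rw [hQμ]
    exact aux_inv γ hγ0 hγ1 Pμ hPμ0 hPμ1 R Rmax hR'
  have hU : ∀ k : ℕ, ∀ s, |((M ^ k) *ᵥ Qμ) s| ≤ (γ * ε / (1 - γ)) ^ k * (Rmax / (1 - γ)) := by
    intro k
    induction k with
    | zero => simpa using hQ
    | succ k ih =>
      intro s
      have h1 := aux_mulVec (Pπ - Pμ) _ ε _ (by positivity) hε' ih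
      have h2 := aux_inv γ hγ0 hγ1 Pμ hPμ0 hPμ1 _ _ h1 s
      have h3 : ((M ^ (k + 1)) *ᵥ Qμ) s
          = γ * ((1 - γ • Pμ)⁻¹ *ᵥ ((Pπ - Pμ) *ᵥ ((M ^ k) *ᵥ Qμ))) s := by
        rw [pow_succ', ← Matrix.mulVec_mulVec]
        generalize (M ^ k) *ᵥ Qμ = w
        rw [hM, Matrix.smul_mulVec, ← Matrix.mulVec_mulVec]
        simp
      rw [h3, abs_mul, abs_of_nonneg hγ0]
      refine (mul_le_mul_of_nonneg_left h2 hγ0).trans (le_of_eq ?_)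
      rw [pow_succ]
      ring
  exact ⟨ciSup_le hQ, fun k _ => ciSup_le (hU k)⟩
end

section
/- (Residual bound, Proposition in Appendix A.1) In the finite matrix MDP setup, suppose 0 < γ, ‖R‖_∞ ≤ Rmax, ‖Pπ - Pμ‖_op ≤ ε, and γ·ε < 1 - γ. Then for every K ≥ 0, the Taylor expansion residual E_K = ∑_{k=K+1}^{∞} Uₖ is a convergent series and ‖E_K‖_∞ ≤ (γ·ε/(1-γ))^(K+1) · (1 - γ·ε/(1-γ))⁻¹ · Rmax/(1-γ). -/
open Matrix

theorem mulVec_norm_le_aux {S : Type*} [Fintype S] (A : Matrix S S ℝ) (c : ℝ) (hc : 0 ≤ c)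
    (hA : ∀ s, ∑ t, |A s t| ≤ c) (v : S → ℝ) : ‖A *ᵥ v‖ ≤ c * ‖v‖ := by
  rw [pi_norm_le_iff_of_nonneg (by positivity)]
  intro s
  rw [Real.norm_eq_abs]
  calc |(A *ᵥ v) s| ≤ ∑ t, |A s t * v t| := Finset.abs_sum_le_sum_abs _ _
    _ ≤ ∑ t, |A s t| * ‖v‖ := by
        refine Finset.sum_le_sum fun t _ => ?_
        rw [abs_mul]
        exact mul_le_mul_of_nonneg_left (norm_le_pi_norm v t) (abs_nonneg _)
    _ = (∑ t, |A s t|) * ‖v‖ := by rw [Finset.sum_mul]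
    _ ≤ c * ‖v‖ := mul_le_mul_of_nonneg_right (hA s) (norm_nonneg _)

theorem resolvent_lower_aux {S : Type*} [Fintype S] [DecidableEq S] (γ : ℝ) (hγ0 : 0 ≤ γ)
    (P : Matrix S S ℝ) (hP0 : ∀ s t, 0 ≤ P s t) (hP1 : ∀ s, ∑ t, P s t = 1) (v : S → ℝ) :
    (1 - γ) * ‖v‖ ≤ ‖(1 - γ • P) *ᵥ v‖ := by
  have h1 : ‖P *ᵥ v‖ ≤ 1 * ‖v‖ := by
    refine mulVec_norm_le_aux P 1 zero_le_one (fun s => ?_) v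
    simp only [abs_of_nonneg (hP0 s _), hP1 s, le_refl]
  have h2 : (1 - γ • P) *ᵥ v = v - γ • (P *ᵥ v) := by
    rw [Matrix.sub_mulVec, Matrix.one_mulVec, Matrix.smul_mulVec]
  have h3 := norm_sub_norm_le v (γ • (P *ᵥ v))
  rw [norm_smul, Real.norm_of_nonneg hγ0] at h3
  rw [h2]
  nlinarith [mul_le_mul_of_nonneg_left h1 hγ0]

theorem resolvent_norm_aux {S : Type*} [Fintype S] [DecidableEq S] (γ : ℝ) (hγ0 : 0 ≤ γ)
    (hγ1 : γ < 1) (P : Matrix S S ℝ) (hP0 : ∀ s t, 0 ≤ P s t) (hP1 : ∀ s, ∑ t, P s t = 1)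
    (w : S → ℝ) : ‖(1 - γ • P)⁻¹ *ᵥ w‖ ≤ ‖w‖ / (1 - γ) := by
  have hg : 0 < 1 - γ := by linarith
  have hdet : IsUnit (1 - γ • P).det := by
    rw [isUnit_iff_ne_zero]
    intro h0
    obtain ⟨v, hv, hv0⟩ := Matrix.exists_mulVec_eq_zero_iff.mpr h0
    have := resolvent_lower_aux γ hγ0 P hP0 hP1 v
    rw [hv0, norm_zero] at this
    have := norm_pos_iff.mpr hv
    nlinarith
  have := resolvent_lower_aux γ hγ0 P hP0 hP1 ((1 - γ • P)⁻¹ *ᵥ w)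
  rw [Matrix.mulVec_mulVec, Matrix.mul_nonsing_inv _ hdet, Matrix.one_mulVec] at this
  rw [le_div_iff₀ hg]
  linarith

/-- **Residual bound (Proposition, Appendix A.1).**
Under `0 < γ`, `‖R‖_∞ ≤ Rmax`, `‖Pπ - Pμ‖_op ≤ ε`, `γ·ε < 1 - γ`, the residual
`E_K = ∑_{k=K+1}^∞ Uₖ` converges and
`‖E_K‖_∞ ≤ (γε/(1-γ))^(K+1) · (1 - γε/(1-γ))⁻¹ · Rmax/(1-γ)`. -/
theorem stmt_8 {S : Type*} [Fintype S] [Nonempty S] [DecidableEq S]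
    (γ : ℝ) (hγ0 : 0 ≤ γ) (hγ1 : γ < 1) (hγpos : 0 < γ)
    (Pπ Pμ : Matrix S S ℝ)
    (hPπ0 : ∀ s t, 0 ≤ Pπ s t) (hPπ1 : ∀ s, ∑ t, Pπ s t = 1)
    (hPμ0 : ∀ s t, 0 ≤ Pμ s t) (hPμ1 : ∀ s, ∑ t, Pμ s t = 1)
    (R : S → ℝ) (Qμ : S → ℝ) (hQμ : Qμ = (1 - γ • Pμ)⁻¹ *ᵥ R)
    (M : Matrix S S ℝ) (hM : M = γ • ((1 - γ • Pμ)⁻¹ * (Pπ - Pμ)))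
    (Rmax ε : ℝ) (hR : vecSupNorm R ≤ Rmax) (hε : matOpNorm (Pπ - Pμ) ≤ ε)
    (hsmall : γ * ε < 1 - γ) (K : ℕ) :
    (∀ s : S, Summable fun k : ℕ => ((M ^ (K + 1 + k)) *ᵥ Qμ) s) ∧
      vecSupNorm (fun s => ∑' k : ℕ, ((M ^ (K + 1 + k)) *ᵥ Qμ) s) ≤
        (γ * ε / (1 - γ)) ^ (K + 1) * (1 - γ * ε / (1 - γ))⁻¹ * (Rmax / (1 - γ)) := by
  have hg : 0 < 1 - γ := by linarith
  have hrow : ∀ s, ∑ t, |(Pπ - Pμ) s t| ≤ ε := fun s =>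
    (le_ciSup (f := fun s => ∑ t, |(Pπ - Pμ) s t|) (Set.finite_range _).bddAbove s).trans hε
  have hRs : ∀ s, |R s| ≤ Rmax := fun s =>
    (le_ciSup (f := fun s => |R s|) (Set.finite_range _).bddAbove s).trans hR
  obtain ⟨s0⟩ := ‹Nonempty S›
  have hε0 : 0 ≤ ε := (Finset.sum_nonneg fun t _ => abs_nonneg _).trans (hrow s0)
  have hR0 : 0 ≤ Rmax := (abs_nonneg _).trans (hRs s0)
  have hRn : ‖R‖ ≤ Rmax := (pi_norm_le_iff_of_nonneg hR0).mpr hRs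
  have hQ : ‖Qμ‖ ≤ Rmax / (1 - γ) := by
    rw [hQμ]
    exact (resolvent_norm_aux γ hγ0 hγ1 Pμ hPμ0 hPμ1 R).trans (by gcongr)
  set q := γ * ε / (1 - γ) with hq
  have hq0 : 0 ≤ q := by positivity
  have hq1 : q < 1 := (div_lt_one hg).mpr hsmall
  have hMv : ∀ v : S → ℝ, ‖M *ᵥ v‖ ≤ q * ‖v‖ := by
    intro v
    rw [hM, Matrix.smul_mulVec, ← Matrix.mulVec_mulVec, norm_smul, Real.norm_of_nonneg hγ0]
    calc γ * ‖(1 - γ • Pμ)⁻¹ *ᵥ ((Pπ - Pμ) *ᵥ v)‖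
        ≤ γ * (ε * ‖v‖ / (1 - γ)) := by
          refine mul_le_mul_of_nonneg_left ?_ hγ0
          refine (resolvent_norm_aux γ hγ0 hγ1 Pμ hPμ0 hPμ1 _).trans ?_
          exact div_le_div_of_nonneg_right (mulVec_norm_le_aux _ ε hε0 hrow v) hg.le
      _ = q * ‖v‖ := by rw [hq]; ring
  have hpow : ∀ n : ℕ, ‖(M ^ n) *ᵥ Qμ‖ ≤ q ^ n * (Rmax / (1 - γ)) := by
    intro n
    induction n with
    | zero => simpa using hQ
    | succ n ih =>
      rw [pow_succ' M, ← Matrix.mulVec_mulVec, pow_succ' q, mul_assoc]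
      exact (hMv _).trans (mul_le_mul_of_nonneg_left ih hq0)
  have hterm : ∀ s (k : ℕ), ‖((M ^ (K + 1 + k)) *ᵥ Qμ) s‖ ≤
      q ^ (K + 1) * (Rmax / (1 - γ)) * q ^ k := by
    intro s k
    refine (norm_le_pi_norm _ s).trans ((hpow _).trans (le_of_eq ?_))
    rw [pow_add]; ring
  have hgeo : HasSum (fun k : ℕ => q ^ (K + 1) * (Rmax / (1 - γ)) * q ^ k)
      (q ^ (K + 1) * (Rmax / (1 - γ)) * (1 - q)⁻¹) :=
    (hasSum_geometric_of_lt_one hq0 hq1).mul_left _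
  refine ⟨fun s => Summable.of_norm_bounded hgeo.summable (hterm s), ?_⟩
  haveI : Nonempty S := ⟨s0⟩
  refine ciSup_le fun s => ?_
  refine (tsum_of_norm_bounded hgeo (hterm s)).trans (le_of_eq ?_)
  ring
end

section
/- In the finite matrix MDP setup with initial distributions, if γ·‖Pπ - Pμ‖_op < 1 - γ, then the series ∑_{k=1}^{∞} Lₖ converges and the RL objective difference decomposes exactly as J(π) - J(μ) = ∑_{k=1}^{∞} Lₖ, where J(π) = π₀ ⬝ᵥ Qπ and J(μ) = μ₀ ⬝ᵥ Qμ. -/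
open Matrix

section Helpers
attribute [local instance] Matrix.linftyOpNormedRing Matrix.linftyOpNormedAlgebra

theorem rowNorm_le {S : Type*} [Fintype S] [DecidableEq S] (A : Matrix S S ℝ) (c : ℝ)
    (hc : 0 ≤ c) (h : ∀ s, ∑ t, |A s t| ≤ c) : ‖A‖ ≤ c := by
  rw [Matrix.linfty_opNorm_def]
  lift c to NNReal using hc
  rw [NNReal.coe_le_coe]
  refine Finset.sup_le fun s _ => ?_
  rw [← NNReal.coe_le_coe]
  simpa using h s

theorem geom_pair {S : Type*} [Fintype S] [Nonempty S] [DecidableEq S]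
    (γ : ℝ) (hγ0 : 0 ≤ γ) (hγ1 : γ < 1) (Pπ Pμ : Matrix S S ℝ)
    (hPπ0 : ∀ s t, 0 ≤ Pπ s t) (hPπ1 : ∀ s, ∑ t, Pπ s t = 1)
    (hPμ0 : ∀ s t, 0 ≤ Pμ s t) (hPμ1 : ∀ s, ∑ t, Pμ s t = 1)
    (R : S → ℝ)
    (M : Matrix S S ℝ) (hM : M = γ • ((1 - γ • Pμ)⁻¹ * (Pπ - Pμ)))
    (hsmall : γ * matOpNorm (Pπ - Pμ) < 1 - γ) (v : S → ℝ) :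
    HasSum (fun k : ℕ => v ⬝ᵥ ((M ^ k) *ᵥ ((1 - γ • Pμ)⁻¹ *ᵥ R)))
      (v ⬝ᵥ ((1 - γ • Pπ)⁻¹ *ᵥ R)) := by
  have hst : ∀ P : Matrix S S ℝ, (∀ s t, 0 ≤ P s t) → (∀ s, ∑ t, P s t = 1) →
      ‖γ • P‖ ≤ γ := by
    intro P h0 h1
    refine rowNorm_le _ _ hγ0 fun s => ?_
    have : ∀ t, |(γ • P) s t| = γ * P s t := fun t => by
      rw [Matrix.smul_apply, smul_eq_mul, abs_of_nonneg (mul_nonneg hγ0 (h0 s t))]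
    simp only [this]
    rw [← Finset.mul_sum, h1, mul_one]
  have hu : ∀ P : Matrix S S ℝ, (∀ s t, 0 ≤ P s t) → (∀ s, ∑ t, P s t = 1) →
      IsUnit (1 - γ • P).det := by
    intro P h0 h1
    rw [← Matrix.isUnit_iff_isUnit_det]
    exact isUnit_one_sub_of_norm_lt_one ((hst P h0 h1).trans_lt hγ1)
  have hone : ‖(1 : Matrix S S ℝ)‖ ≤ 1 := by
    refine rowNorm_le _ _ zero_le_one fun s => ?_
    simp [Matrix.one_apply, apply_ite abs]
  have hN := Matrix.mul_nonsing_inv _ (hu Pμ hPμ0 hPμ1)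
  have hNπ := Matrix.nonsing_inv_mul _ (hu Pπ hPπ0 hPπ1)
  have hNb : (1 - γ) * ‖(1 - γ • Pμ)⁻¹‖ ≤ 1 := by
    set N := (1 - γ • Pμ)⁻¹ with hNd
    have e : N = 1 + (γ • Pμ) * N := by
      rw [sub_mul, one_mul] at hN
      rw [← hN]; abel
    have h1 : ‖N‖ ≤ 1 + γ * ‖N‖ := by
      calc ‖N‖ = ‖1 + (γ • Pμ) * N‖ := by rw [← e]
        _ ≤ ‖(1 : Matrix S S ℝ)‖ + ‖(γ • Pμ) * N‖ := norm_add_le _ _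
        _ ≤ 1 + ‖γ • Pμ‖ * ‖N‖ := add_le_add hone (norm_mul_le _ _)
        _ ≤ 1 + γ * ‖N‖ := by gcongr; exact hst Pμ hPμ0 hPμ1
    linarith
  have hrow : ∀ s, ∑ t, |(Pπ - Pμ) s t| ≤ matOpNorm (Pπ - Pμ) := fun s =>
    le_ciSup (f := fun s => ∑ t, |(Pπ - Pμ) s t|) (Set.finite_range _).bddAbove s
  have hD0 : 0 ≤ matOpNorm (Pπ - Pμ) :=
    (Finset.sum_nonneg fun t _ => abs_nonneg _).trans (hrow (Classical.arbitrary S))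
  have hD : ‖Pπ - Pμ‖ ≤ matOpNorm (Pπ - Pμ) := rowNorm_le _ _ hD0 hrow
  have hM1 : ‖M‖ < 1 := by
    have h1 : ‖M‖ ≤ γ * (‖(1 - γ • Pμ)⁻¹‖ * matOpNorm (Pπ - Pμ)) := by
      rw [hM, norm_smul, Real.norm_of_nonneg hγ0]
      gcongr
      exact (norm_mul_le _ _).trans (by gcongr)
    have hg : 0 < 1 - γ := by linarith
    have h0 := norm_nonneg ((1 - γ • Pμ)⁻¹)
    have hx : 0 ≤ γ * matOpNorm (Pπ - Pμ) := mul_nonneg hγ0 hD0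
    have h2 : (1 - γ) * ‖M‖ ≤ γ * matOpNorm (Pπ - Pμ) := by
      calc (1 - γ) * ‖M‖ ≤ (1 - γ) * (γ * (‖(1 - γ • Pμ)⁻¹‖ * matOpNorm (Pπ - Pμ))) := by
            gcongr
        _ = ((1 - γ) * ‖(1 - γ • Pμ)⁻¹‖) * (γ * matOpNorm (Pπ - Pμ)) := by ring
        _ ≤ 1 * (γ * matOpNorm (Pπ - Pμ)) := by gcongr
        _ = _ := one_mul _
    by_contra hc
    push Not at hc
    nlinarith
  have hS : Summable (fun k : ℕ => M ^ k) := summable_geometric_of_norm_lt_one hM1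
  have hT := geom_series_mul_neg M hM1
  have hfac : (1 - γ • Pμ) * (1 - M) = 1 - γ • Pπ := by
    rw [mul_sub, mul_one, hM, Matrix.mul_smul, ← Matrix.mul_assoc, hN, one_mul, smul_sub]
    abel
  have hkey : (∑' k : ℕ, M ^ k) * (1 - γ • Pμ)⁻¹ = (1 - γ • Pπ)⁻¹ := by
    symm
    apply Matrix.inv_eq_left_inv
    rw [← hfac, Matrix.mul_assoc, ← Matrix.mul_assoc (1 - γ • Pμ)⁻¹,
      Matrix.nonsing_inv_mul _ (hu Pμ hPμ0 hPμ1), one_mul]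
    exact hT
  rw [← hkey, ← Matrix.mulVec_mulVec]
  generalize (1 - γ • Pμ)⁻¹ *ᵥ R = w
  let f : Matrix S S ℝ →ₗ[ℝ] ℝ :=
    { toFun := fun A => v ⬝ᵥ (A *ᵥ w)
      map_add' := fun A B => by rw [Matrix.add_mulVec, dotProduct_add]
      map_smul' := fun c A => by simp [Matrix.smul_mulVec] }
  exact hS.hasSum.map f f.continuous_of_finiteDimensional

end Helpers

/-- **Exact Taylor expansion of the RL objective.**
If `γ·‖Pπ - Pμ‖_op < 1 - γ`, then `∑_{k=1}^∞ Lₖ` converges and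
`J(π) - J(μ) = ∑_{k=1}^∞ Lₖ`, where `J(π) = π₀ ⬝ᵥ Qπ` and `J(μ) = μ₀ ⬝ᵥ Qμ`. -/
theorem stmt_11 {S : Type*} [Fintype S] [Nonempty S] [DecidableEq S]
    (γ : ℝ) (hγ0 : 0 ≤ γ) (hγ1 : γ < 1)
    (Pπ Pμ : Matrix S S ℝ)
    (hPπ0 : ∀ s t, 0 ≤ Pπ s t) (hPπ1 : ∀ s, ∑ t, Pπ s t = 1)
    (hPμ0 : ∀ s t, 0 ≤ Pμ s t) (hPμ1 : ∀ s, ∑ t, Pμ s t = 1)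
    (R : S → ℝ) (Qπ Qμ : S → ℝ)
    (hQπ : Qπ = (1 - γ • Pπ)⁻¹ *ᵥ R) (hQμ : Qμ = (1 - γ • Pμ)⁻¹ *ᵥ R)
    (M : Matrix S S ℝ) (hM : M = γ • ((1 - γ • Pμ)⁻¹ * (Pπ - Pμ)))
    (π₀ μ₀ : S → ℝ)
    (hπ₀0 : ∀ s, 0 ≤ π₀ s) (hπ₀1 : ∑ s, π₀ s = 1)
    (hμ₀0 : ∀ s, 0 ≤ μ₀ s) (hμ₀1 : ∑ s, μ₀ s = 1)
    (L : ℕ → ℝ)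
    (hL1 : L 1 = (π₀ - μ₀) ⬝ᵥ Qμ + μ₀ ⬝ᵥ ((M ^ 1) *ᵥ Qμ))
    (hLk : ∀ k : ℕ, 2 ≤ k →
      L k = (π₀ - μ₀) ⬝ᵥ ((M ^ (k - 1)) *ᵥ Qμ) + μ₀ ⬝ᵥ ((M ^ k) *ᵥ Qμ))
    (hsmall : γ * matOpNorm (Pπ - Pμ) < 1 - γ) :
    HasSum (fun k : ℕ => L (k + 1)) (π₀ ⬝ᵥ Qπ - μ₀ ⬝ᵥ Qμ) := by
  have H := geom_pair γ hγ0 hγ1 Pπ Pμ hPπ0 hPπ1 hPμ0 hPμ1 R M hM hsmall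
  rw [← hQπ, ← hQμ] at H
  have h1 := H (π₀ - μ₀)
  have h2 := (hasSum_nat_add_iff' 1).mpr (H μ₀)
  have h3 := h1.add h2
  convert h3 using 1
  · funext k
    rcases Nat.eq_zero_or_pos k with rfl | hk
    · simpa using hL1
    · simpa using hLk (k + 1) (by omega)
  · simp [sub_dotProduct]
end

section
/- (Theorem 3, baseline invariance / variance reduction) In the explicit MDP setup with discount γ (0 ≤ γ < 1), reward R : S → ℝ, Qμ = (1 - γ•Pμ)⁻¹ *ᵥ R, M = γ•((1 - γ•Pμ)⁻¹ * (Pπ - Pμ)), and Uₖ = M^k *ᵥ Qμ, fix any baseline V : X → ℝ and define the advantage-like vector Aμ (x,a) = Qμ (x,a) - V x. Fix x₀ : X and set π₀ (x,a) = if x = x₀ then π x₀ a else 0, μ₀ (x,a) = if x = x₀ then μ x₀ a else 0. Then for every k ≥ 1: M^k *ᵥ Aμ = Uₖ, and moreover (π₀ - μ₀) ⬝ᵥ (M^(k-1) *ᵥ Aμ) + μ₀ ⬝ᵥ (M^k *ᵥ Aμ) = (π₀ - μ₀) ⬝ᵥ (M^(k-1) *ᵥ Qμ) + μ₀ ⬝ᵥ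 (M^k *ᵥ Qμ); i.e., the k-th order expansion terms Lₖ are unchanged when Qμ is replaced by Aμ. -/
open Matrix

/-- **Theorem 3 (baseline invariance / variance reduction).**
Replacing `Qμ` by the advantage `Aμ (x,a) = Qμ (x,a) - V x` leaves all Taylor
expansion terms unchanged: `M^k *ᵥ Aμ = Uₖ` for `k ≥ 1`, and the `k`-th order
objective terms `Lₖ` coincide. -/
theorem stmt_14 {X A : Type*} [Fintype X] [Fintype A] [Nonempty X] [Nonempty A]
    [DecidableEq X] [DecidableEq A]
    (p : X → A → X → ℝ) (hp0 : ∀ x a y, 0 ≤ p x a y) (hp1 : ∀ x a, ∑ y, p x a y = 1)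
    (π μ : X → A → ℝ)
    (hπ0 : ∀ x a, 0 ≤ π x a) (hπ1 : ∀ x, ∑ a, π x a = 1)
    (hμ0 : ∀ x a, 0 ≤ μ x a) (hμ1 : ∀ x, ∑ a, μ x a = 1)
    (Pπ Pμ : Matrix (X × A) (X × A) ℝ)
    (hPπ : ∀ s t, Pπ s t = p s.1 s.2 t.1 * π t.1 t.2)
    (hPμ : ∀ s t, Pμ s t = p s.1 s.2 t.1 * μ t.1 t.2)
    (γ : ℝ) (hγ0 : 0 ≤ γ) (hγ1 : γ < 1)
    (R : X × A → ℝ) (Qμ : X × A → ℝ) (hQμ : Qμ = (1 - γ • Pμ)⁻¹ *ᵥ R)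
    (M : Matrix (X × A) (X × A) ℝ) (hM : M = γ • ((1 - γ • Pμ)⁻¹ * (Pπ - Pμ)))
    (V : X → ℝ) (Aμ : X × A → ℝ) (hAμ : ∀ s : X × A, Aμ s = Qμ s - V s.1)
    (x₀ : X) (π₀ μ₀ : X × A → ℝ)
    (hπ₀ : ∀ s : X × A, π₀ s = if s.1 = x₀ then π x₀ s.2 else 0)
    (hμ₀ : ∀ s : X × A, μ₀ s = if s.1 = x₀ then μ x₀ s.2 else 0) :
    ∀ k : ℕ, 1 ≤ k →
      (M ^ k) *ᵥ Aμ = (M ^ k) *ᵥ Qμ ∧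
      (π₀ - μ₀) ⬝ᵥ ((M ^ (k - 1)) *ᵥ Aμ) + μ₀ ⬝ᵥ ((M ^ k) *ᵥ Aμ) =
        (π₀ - μ₀) ⬝ᵥ ((M ^ (k - 1)) *ᵥ Qμ) + μ₀ ⬝ᵥ ((M ^ k) *ᵥ Qμ) := by
  have hA : Aμ = Qμ - (fun s : X × A => V s.1) := by
    funext s; simp [hAμ]
  have hP : (Pπ - Pμ) *ᵥ (fun s : X × A => V s.1) = 0 := by
    funext s
    simp only [mulVec, dotProduct, Matrix.sub_apply, hPπ, hPμ, Fintype.sum_prod_type,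
      Pi.zero_apply]
    apply Finset.sum_eq_zero
    intro y _
    have h : ∀ b, (p s.1 s.2 y * π y b - p s.1 s.2 y * μ y b) * V y
        = (p s.1 s.2 y * V y) * (π y b - μ y b) := fun b => by ring
    simp only [h, ← Finset.mul_sum, Finset.sum_sub_distrib, hπ1, hμ1, sub_self, mul_zero]
  have hMW : M *ᵥ (fun s : X × A => V s.1) = 0 := by
    rw [hM, smul_mulVec, ← mulVec_mulVec, hP, mulVec_zero, smul_zero]
  have hMk : ∀ n : ℕ, (M ^ (n + 1)) *ᵥ Aμ = (M ^ (n + 1)) *ᵥ Qμ := by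
    intro n
    rw [hA, mulVec_sub, pow_succ, ← mulVec_mulVec (fun s : X × A => V s.1), hMW,
      mulVec_zero, sub_zero]
  have h0 : (π₀ - μ₀) ⬝ᵥ (fun s : X × A => V s.1) = 0 := by
    simp only [dotProduct, Pi.sub_apply, hπ₀, hμ₀, Fintype.sum_prod_type]
    apply Finset.sum_eq_zero
    intro y _
    rw [← Finset.sum_mul]
    by_cases hy : y = x₀
    · simp [hy, Finset.sum_sub_distrib, hπ1, hμ1]
    · simp [hy]
  intro k hk
  obtain ⟨n, rfl⟩ : ∃ n, k = n + 1 := ⟨k - 1, by omega⟩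
  refine ⟨hMk n, ?_⟩
  rw [hMk n, Nat.add_sub_cancel]
  congr 1
  cases n with
  | zero => rw [pow_zero, one_mulVec, one_mulVec, hA, dotProduct_sub, h0, sub_zero]
  | succ m => rw [hMk m]
end

section
/- In the finite matrix MDP setup, let R₁ Q = Q + (1 - γ•Pμ)⁻¹ *ᵥ (R + γ•(Pπ *ᵥ Q) - Q) and M = γ•((1 - γ•Pμ)⁻¹ * (Pπ - Pμ)). Then for every K ≥ 1 and every initial vector Q : S → ℝ, the K-fold iterate satisfies R₁^[K] Q = Qμ + ∑_{k=1}^{K-1} M^k *ᵥ Qμ + M^K *ᵥ Q. -/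
open Matrix

/-- **K-fold iterate of the return-based off-policy evaluation operator (c ≡ 1).**
`R₁^[K] Q = Qμ + ∑_{k=1}^{K-1} M^k *ᵥ Qμ + M^K *ᵥ Q` for every `K ≥ 1`. -/
theorem stmt_16 {S : Type*} [Fintype S] [Nonempty S] [DecidableEq S]
    (γ : ℝ) (hγ0 : 0 ≤ γ) (hγ1 : γ < 1)
    (Pπ Pμ : Matrix S S ℝ)
    (hPπ0 : ∀ s t, 0 ≤ Pπ s t) (hPπ1 : ∀ s, ∑ t, Pπ s t = 1)
    (hPμ0 : ∀ s t, 0 ≤ Pμ s t) (hPμ1 : ∀ s, ∑ t, Pμ s t = 1)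
    (R : S → ℝ) (Qμ : S → ℝ) (hQμ : Qμ = (1 - γ • Pμ)⁻¹ *ᵥ R)
    (M : Matrix S S ℝ) (hM : M = γ • ((1 - γ • Pμ)⁻¹ * (Pπ - Pμ)))
    (R₁ : (S → ℝ) → S → ℝ)
    (hR₁ : ∀ Q : S → ℝ, R₁ Q = Q + (1 - γ • Pμ)⁻¹ *ᵥ (R + γ • (Pπ *ᵥ Q) - Q)) :
    ∀ K : ℕ, 1 ≤ K → ∀ Q : S → ℝ,
      R₁^[K] Q = Qμ + (∑ k ∈ Finset.Icc 1 (K - 1), (M ^ k) *ᵥ Qμ) + (M ^ K) *ᵥ Q := by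
  have hdet : (1 - γ • Pμ).det ≠ 0 := by
    apply det_ne_zero_of_sum_row_lt_diag
    intro k
    have hsum : ∑ j ∈ Finset.univ.erase k, Pμ k j = 1 - Pμ k k := by
      have := Finset.sum_erase_add Finset.univ (fun j => Pμ k j) (Finset.mem_univ k)
      rw [hPμ1 k] at this
      linarith
    have hle : 0 ≤ 1 - Pμ k k := by
      rw [← hsum]
      exact Finset.sum_nonneg fun j _ => hPμ0 k j
    have h1 : ∑ j ∈ Finset.univ.erase k, ‖(1 - γ • Pμ) k j‖ = γ * (1 - Pμ k k) := by
      rw [← hsum, Finset.mul_sum]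
      apply Finset.sum_congr rfl
      intro j hj
      have hkj : k ≠ j := fun h => (Finset.ne_of_mem_erase hj) h.symm
      simp [Matrix.sub_apply, Matrix.one_apply_ne hkj, abs_of_nonneg hγ0,
        abs_of_nonneg (hPμ0 k j)]
    rw [h1]
    refine lt_of_lt_of_le ?_ (Real.le_norm_self _)
    simp only [Matrix.sub_apply, Matrix.one_apply_eq, Matrix.smul_apply, smul_eq_mul]
    linarith
  have hinv : (1 - γ • Pμ)⁻¹ * (1 - γ • Pμ) = 1 :=
    Matrix.nonsing_inv_mul _ (isUnit_iff_ne_zero.mpr hdet)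
  have hstep : ∀ Q, R₁ Q = Qμ + M *ᵥ Q := by
    intro Q
    have hQ : Q = (1 - γ • Pμ)⁻¹ *ᵥ ((1 - γ • Pμ) *ᵥ Q) := by
      rw [Matrix.mulVec_mulVec, hinv, Matrix.one_mulVec]
    have e : M *ᵥ Q = (1 - γ • Pμ)⁻¹ *ᵥ (γ • (Pπ *ᵥ Q) - γ • (Pμ *ᵥ Q)) := by
      rw [hM, Matrix.smul_mulVec, ← Matrix.mulVec_mulVec, Matrix.sub_mulVec, ← smul_sub,
        Matrix.mulVec_smul]
    rw [hR₁, e, hQμ]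
    nth_rewrite 1 [hQ]
    rw [← Matrix.mulVec_add, ← Matrix.mulVec_add, Matrix.sub_mulVec, Matrix.one_mulVec,
      Matrix.smul_mulVec]
    congr 1
    abel
  intro K hK
  induction K, hK using Nat.le_induction with
  | base => intro Q; simp [hstep]
  | succ n hn ih =>
    intro Q
    rw [Function.iterate_succ_apply, ih, hstep, Matrix.mulVec_add, Matrix.mulVec_mulVec,
      ← pow_succ]
    obtain ⟨m, rfl⟩ : ∃ m, n = m + 1 := ⟨n - 1, by omega⟩
    simp only [Nat.add_sub_cancel]
    rw [Finset.sum_Icc_succ_top (by omega : 1 ≤ m + 1)]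
    abel
end

section
/- (Theorem 4) In the finite matrix MDP setup, let R₁ Q = Q + (1 - γ•Pμ)⁻¹ *ᵥ (R + γ•(Pπ *ᵥ Q) - Q), M = γ•((1 - γ•Pμ)⁻¹ * (Pπ - Pμ)), and Uₖ = M^k *ᵥ Qμ. Then for every K ≥ 1, the K-th order Taylor expansion of the Q-function coincides with K applications of the operator to Qμ: Qμ + ∑_{k=1}^{K} Uₖ = R₁^[K] Qμ. -/
open Matrix

/-- **Theorem 4 (Taylor expansion as off-policy evaluation).**
For every `K ≥ 1`, `Qμ + ∑_{k=1}^{K} Uₖ = R₁^[K] Qμ`, where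
`R₁ Q = Q + (1 - γ•Pμ)⁻¹ *ᵥ (R + γ•(Pπ *ᵥ Q) - Q)` and `Uₖ = M^k *ᵥ Qμ`. -/
theorem stmt_17 {S : Type*} [Fintype S] [Nonempty S] [DecidableEq S]
    (γ : ℝ) (hγ0 : 0 ≤ γ) (hγ1 : γ < 1)
    (Pπ Pμ : Matrix S S ℝ)
    (hPπ0 : ∀ s t, 0 ≤ Pπ s t) (hPπ1 : ∀ s, ∑ t, Pπ s t = 1)
    (hPμ0 : ∀ s t, 0 ≤ Pμ s t) (hPμ1 : ∀ s, ∑ t, Pμ s t = 1)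
    (R : S → ℝ) (Qμ : S → ℝ) (hQμ : Qμ = (1 - γ • Pμ)⁻¹ *ᵥ R)
    (M : Matrix S S ℝ) (hM : M = γ • ((1 - γ • Pμ)⁻¹ * (Pπ - Pμ)))
    (R₁ : (S → ℝ) → S → ℝ)
    (hR₁ : ∀ Q : S → ℝ, R₁ Q = Q + (1 - γ • Pμ)⁻¹ *ᵥ (R + γ • (Pπ *ᵥ Q) - Q)) :
    ∀ K : ℕ, 1 ≤ K →
      Qμ + (∑ k ∈ Finset.Icc 1 K, (M ^ k) *ᵥ Qμ) = R₁^[K] Qμ := by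
  have hdet : (1 - γ • Pμ).det ≠ 0 := by
    apply det_ne_zero_of_sum_row_lt_diag
    intro k
    have h1 : ∑ j ∈ Finset.univ.erase k, ‖(1 - γ • Pμ) k j‖
        = ∑ j ∈ Finset.univ.erase k, γ * Pμ k j := by
      refine Finset.sum_congr rfl fun j hj => ?_
      have hjk : k ≠ j := (Finset.ne_of_mem_erase hj).symm
      simp [Matrix.one_apply_ne hjk, abs_of_nonneg hγ0, abs_of_nonneg (hPμ0 k j)]
    have h2 := Finset.add_sum_erase Finset.univ (fun j => Pμ k j) (Finset.mem_univ k)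
    rw [hPμ1 k] at h2
    have h3 : (1 - γ • Pμ) k k ≤ ‖(1 - γ • Pμ) k k‖ := Real.le_norm_self _
    have h4 : (1 - γ • Pμ) k k = 1 - γ * Pμ k k := by simp
    rw [h1, ← Finset.mul_sum]
    have h5 : ∑ j ∈ Finset.univ.erase k, Pμ k j = 1 - Pμ k k := by linarith
    rw [h5]
    linarith
  have hinv : (1 - γ • Pμ)⁻¹ * (1 - γ • Pμ) = 1 :=
    Matrix.nonsing_inv_mul _ (isUnit_iff_ne_zero.mpr hdet)
  have key : ∀ Q, R₁ Q = Qμ + M *ᵥ Q := by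
    intro Q
    have hQ : Q = (1 - γ • Pμ)⁻¹ *ᵥ (Q - γ • (Pμ *ᵥ Q)) := by
      have h : Q - γ • (Pμ *ᵥ Q) = (1 - γ • Pμ) *ᵥ Q := by
        rw [Matrix.sub_mulVec, Matrix.one_mulVec, Matrix.smul_mulVec]
      rw [h, Matrix.mulVec_mulVec, hinv, Matrix.one_mulVec]
    rw [hR₁]
    nth_rewrite 1 [hQ]
    rw [hQμ, hM, Matrix.smul_mulVec, ← Matrix.mulVec_mulVec, ← Matrix.mulVec_smul (1 - γ • Pμ)⁻¹,
      ← Matrix.mulVec_add, ← Matrix.mulVec_add, Matrix.sub_mulVec, smul_sub]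
    congr 1
    abel
  intro K _
  have main : ∀ K : ℕ, ∑ k ∈ Finset.range (K + 1), (M ^ k) *ᵥ Qμ = R₁^[K] Qμ := by
    intro K
    induction K with
    | zero => simp
    | succ n ih =>
      rw [Function.iterate_succ_apply', ← ih, key, Finset.sum_range_succ', Matrix.mulVec_sum,
        add_comm]
      simp [Matrix.mulVec_mulVec, pow_succ']
  rw [← main K, Finset.sum_range_succ', add_comm, Finset.range_eq_Ico,
    Finset.sum_Ico_add' (fun k => (M ^ k) *ᵥ Qμ) 0 K 1]
  simp only [pow_zero, Matrix.one_mulVec, zero_add]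
  rfl
end

section
/- (Convergence of Q(λ) with λ = 1 from Qμ) In the finite matrix MDP setup, let R₁ Q = Q + (1 - γ•Pμ)⁻¹ *ᵥ (R + γ•(Pπ *ᵥ Q) - Q). If γ·‖Pπ - Pμ‖_op < 1 - γ, then the iterates R₁^[K] Qμ converge to Qπ as K → ∞ (in the sup norm ‖·‖_∞ on S → ℝ). -/
open Matrix Filter

lemma abs_le_vecSupNorm {S : Type*} [Fintype S] (v : S → ℝ) (s : S) : |v s| ≤ vecSupNorm v :=
  le_ciSup (f := fun s => |v s|) (Set.finite_range _).bddAbove s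

lemma vecSupNorm_nonneg {S : Type*} [Fintype S] (v : S → ℝ) : 0 ≤ vecSupNorm v :=
  Real.iSup_nonneg fun _ => abs_nonneg _

lemma abs_mulVec_le {S : Type*} [Fintype S] (A : Matrix S S ℝ) (v : S → ℝ) (s : S) :
    |(A *ᵥ v) s| ≤ matOpNorm A * vecSupNorm v := by
  calc |(A *ᵥ v) s| = |∑ t, A s t * v t| := rfl
    _ ≤ ∑ t, |A s t * v t| := Finset.abs_sum_le_sum_abs _ _
    _ ≤ ∑ t, |A s t| * vecSupNorm v := by
        refine Finset.sum_le_sum fun t _ => ?_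
        rw [abs_mul]
        exact mul_le_mul_of_nonneg_left (abs_le_vecSupNorm v t) (abs_nonneg _)
    _ = (∑ t, |A s t|) * vecSupNorm v := by rw [Finset.sum_mul]
    _ ≤ matOpNorm A * vecSupNorm v :=
        mul_le_mul_of_nonneg_right
          (le_ciSup (f := fun s => ∑ t, |A s t|) (Set.finite_range _).bddAbove s)
          (vecSupNorm_nonneg v)

lemma matOpNorm_stoch {S : Type*} [Fintype S] [Nonempty S] (P : Matrix S S ℝ)
    (h0 : ∀ s t, 0 ≤ P s t) (h1 : ∀ s, ∑ t, P s t = 1) : matOpNorm P = 1 := by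
  simp [matOpNorm, abs_of_nonneg (h0 _ _), h1]

/-- Key estimate. -/
lemma key_bound {S : Type*} [Fintype S] [Nonempty S]
    (γ : ℝ) (hγ0 : 0 ≤ γ) (hγ1 : γ < 1) (P A : Matrix S S ℝ)
    (h0 : ∀ s t, 0 ≤ P s t) (h1 : ∀ s, ∑ t, P s t = 1) (d e : S → ℝ)
    (h : e = γ • (P *ᵥ e) + γ • (A *ᵥ d)) :
    vecSupNorm e ≤ γ * matOpNorm A / (1 - γ) * vecSupNorm d := by
  have hb : vecSupNorm e ≤ γ * vecSupNorm e + γ * (matOpNorm A * vecSupNorm d) := by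
    refine ciSup_le fun s => ?_
    have hs := congrFun h s
    simp only [Pi.add_apply, Pi.smul_apply, smul_eq_mul] at hs
    have hp := abs_mulVec_le P e s
    rw [matOpNorm_stoch P h0 h1, one_mul] at hp
    have ha := abs_mulVec_le A d s
    rw [hs]
    refine (abs_add_le _ _).trans ?_
    rw [abs_mul, abs_mul, abs_of_nonneg hγ0]
    gcongr
  have : 0 < 1 - γ := by linarith
  rw [div_mul_eq_mul_div, le_div_iff₀ this]
  linarith

lemma isUnit_det_sub {S : Type*} [Fintype S] [Nonempty S] [DecidableEq S]
    (γ : ℝ) (hγ0 : 0 ≤ γ) (hγ1 : γ < 1) (P : Matrix S S ℝ)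
    (h0 : ∀ s t, 0 ≤ P s t) (h1 : ∀ s, ∑ t, P s t = 1) : IsUnit (1 - γ • P).det := by
  rw [← Matrix.isUnit_iff_isUnit_det, ← Matrix.mulVec_injective_iff_isUnit]
  intro v w hvw
  have hz : v - w = γ • (P *ᵥ (v - w)) + γ • ((0 : Matrix S S ℝ) *ᵥ (v - w)) := by
    simp only [sub_mulVec, one_mulVec, smul_mulVec] at hvw
    rw [zero_mulVec, smul_zero, add_zero, mulVec_sub, smul_sub]
    funext s
    have := congrFun hvw s
    simp only [Pi.sub_apply] at this ⊢
    linarith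
  have hb := key_bound γ hγ0 hγ1 P 0 h0 h1 _ _ hz
  have hm : matOpNorm (0 : Matrix S S ℝ) = 0 := by simp [matOpNorm]
  rw [hm, mul_zero, zero_div, zero_mul] at hb
  funext s
  have := (abs_le_vecSupNorm (v - w) s).trans hb
  have := abs_nonpos_iff.mp this
  exact sub_eq_zero.mp this

/-- **Convergence of Q(λ) with λ = 1 starting from Qμ.**
If `γ·‖Pπ - Pμ‖_op < 1 - γ` then the iterates `R₁^[K] Qμ` converge to `Qπ`
in the sup norm as `K → ∞`. -/
theorem stmt_18 {S : Type*} [Fintype S] [Nonempty S] [DecidableEq S]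
    (γ : ℝ) (hγ0 : 0 ≤ γ) (hγ1 : γ < 1)
    (Pπ Pμ : Matrix S S ℝ)
    (hPπ0 : ∀ s t, 0 ≤ Pπ s t) (hPπ1 : ∀ s, ∑ t, Pπ s t = 1)
    (hPμ0 : ∀ s t, 0 ≤ Pμ s t) (hPμ1 : ∀ s, ∑ t, Pμ s t = 1)
    (R : S → ℝ) (Qπ Qμ : S → ℝ)
    (hQπ : Qπ = (1 - γ • Pπ)⁻¹ *ᵥ R) (hQμ : Qμ = (1 - γ • Pμ)⁻¹ *ᵥ R)
    (R₁ : (S → ℝ) → S → ℝ)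
    (hR₁ : ∀ Q : S → ℝ, R₁ Q = Q + (1 - γ • Pμ)⁻¹ *ᵥ (R + γ • (Pπ *ᵥ Q) - Q))
    (hsmall : γ * matOpNorm (Pπ - Pμ) < 1 - γ) :
    Tendsto (fun K : ℕ => vecSupNorm (R₁^[K] Qμ - Qπ)) atTop (nhds 0) := by
  have hUμ := isUnit_det_sub γ hγ0 hγ1 Pμ hPμ0 hPμ1
  have hUπ := isUnit_det_sub γ hγ0 hγ1 Pπ hPπ0 hPπ1
  have hRπ : Qπ - γ • (Pπ *ᵥ Qπ) = R := by
    have : (1 - γ • Pπ) *ᵥ Qπ = R := by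
      rw [hQπ, mulVec_mulVec, Matrix.mul_nonsing_inv _ hUπ, one_mulVec]
    simpa only [sub_mulVec, one_mulVec, smul_mulVec] using this
  set c := γ * matOpNorm (Pπ - Pμ) / (1 - γ) with hc
  have h1γ : 0 < 1 - γ := by linarith
  have hM : 0 ≤ matOpNorm (Pπ - Pμ) :=
    Real.iSup_nonneg fun _ => Finset.sum_nonneg fun _ _ => abs_nonneg _
  have hc0 : 0 ≤ c := by positivity
  have hc1 : c < 1 := by rwa [hc, div_lt_one h1γ]
  have step : ∀ Q, vecSupNorm (R₁ Q - Qπ) ≤ c * vecSupNorm (Q - Qπ) := by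
    intro Q
    refine key_bound γ hγ0 hγ1 Pμ (Pπ - Pμ) hPμ0 hPμ1 _ _ ?_
    have h : (1 - γ • Pμ) *ᵥ (R₁ Q - Q) = R + γ • (Pπ *ᵥ Q) - Q := by
      rw [hR₁, add_sub_cancel_left, mulVec_mulVec, Matrix.mul_nonsing_inv _ hUμ, one_mulVec]
    rw [← hRπ] at h
    simp only [sub_mulVec, one_mulVec, smul_mulVec, mulVec_sub] at h ⊢
    funext s
    have := congrFun h s
    simp only [Pi.sub_apply, Pi.add_apply, Pi.smul_apply, smul_eq_mul] at this ⊢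
    linarith
  have iter : ∀ K : ℕ, vecSupNorm (R₁^[K] Qμ - Qπ) ≤ c ^ K * vecSupNorm (Qμ - Qπ) := by
    intro K
    induction K with
    | zero => simp
    | succ k ih =>
      rw [Function.iterate_succ_apply', pow_succ', mul_assoc]
      exact (step _).trans (mul_le_mul_of_nonneg_left ih hc0)
  refine squeeze_zero (fun _ => vecSupNorm_nonneg _) iter ?_
  simpa using (tendsto_pow_atTop_nhds_zero_of_lt_one hc0 hc1).mul_const (vecSupNorm (Qμ - Qπ))
end
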